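/- Let ε > 0 and let S ⊆ {0,…,N−1} contain the qualified index set Q_{c,B,ε/(B(1+ε))}. Then the (unsquared) Euclidean error satisfies ‖c·1_S − c‖₂ ≤ (1+ε)·‖c_opt − c‖₂. -/

import Mathlib

/-- The tail sum `∑_{i=j}^{N-1} c_i²`. -/
noncomputable def tailSum (N : ℕ) (c : Fin N → ℝ) (j : ℕ) : ℝ :=
  ∑ i ∈ Finset.univ.filter (fun i : Fin N => j ≤ (i : ℕ)), c i ^ 2

/-- The qualified length `m(c,ℓ,θ)`: the least `j < ℓ` with
`c_j² < θ·∑_{i=j}^{N-1} c_i²`, or `ℓ` if no such `j` exists. -/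
noncomputable def qualLen (N : ℕ) (c : Fin N → ℝ) (ℓ : ℕ) (θ : ℝ) : ℕ :=
  sInf ({j : ℕ | ∃ hj : j < N, j < ℓ ∧ c ⟨j, hj⟩ ^ 2 < θ * tailSum N c j} ∪ {ℓ})

theorem tailSum_nonneg (N : ℕ) (c : Fin N → ℝ) (j : ℕ) : 0 ≤ tailSum N c j :=
  Finset.sum_nonneg fun _ _ => sq_nonneg _

/-- Restricting `c` to a set containing the prefix `{0,…,j-1}` leaves a squared error of at most
the tail sum from `j`. -/
theorem sum_sq_restrict_sub_le_tailSum {N : ℕ} (c : Fin N → ℝ) (j : ℕ) (S : Finset (Fin N))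
    (hS : ∀ i : Fin N, (i : ℕ) < j → i ∈ S) :
    ∑ i : Fin N, ((if i ∈ S then c i else 0) - c i) ^ 2 ≤ tailSum N c j := by
  rw [tailSum, Finset.sum_filter]
  refine Finset.sum_le_sum fun i _ => ?_
  by_cases hi : i ∈ S
  · simp only [hi, if_true, sub_self, ne_eq, OfNat.ofNat_ne_zero, not_false_eq_true, zero_pow]
    split_ifs
    · positivity
    · exact le_rfl
  · have hj : j ≤ (i : ℕ) := not_lt.mp fun h => hi (hS i h)
    simp [hi, hj]

theorem sum_sq_prefix_sub_eq_tailSum {N : ℕ} (c : Fin N → ℝ) (B : ℕ) :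
    ∑ i : Fin N, ((if (i : ℕ) < B then c i else 0) - c i) ^ 2 = tailSum N c B := by
  rw [tailSum, Finset.sum_filter]
  refine Finset.sum_congr rfl fun i _ => ?_
  by_cases hi : (i : ℕ) < B
  · simp [hi]
  · simp [hi, not_lt.mp hi]

/-- For a vector sorted by magnitude, the tail sums from `j` and from `B` differ by at most
`B · c_j²`. -/
theorem tailSum_le_mul_sq_add_tailSum {N : ℕ} (c : Fin N → ℝ)
    (hsorted : ∀ i j : Fin N, i ≤ j → |c j| ≤ |c i|) (B : ℕ) (j : Fin N) :
    tailSum N c j ≤ B * c j ^ 2 + tailSum N c B := by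
  have hterm : ∀ i : Fin N, (if (j : ℕ) ≤ (i : ℕ) then c i ^ 2 else 0)
      ≤ (if (i : ℕ) < B then c j ^ 2 else 0) + (if B ≤ (i : ℕ) then c i ^ 2 else 0) := by
    intro i
    by_cases hB : (i : ℕ) < B
    · by_cases hj : (j : ℕ) ≤ (i : ℕ)
      · simpa [hB, hj, not_le.mpr hB] using sq_le_sq.mpr (hsorted j i hj)
      · simpa [hB, hj, not_le.mpr hB] using sq_nonneg (c j)
    · simp only [hB, not_lt.mp hB, if_true, if_false, zero_add]
      split_ifs
      · exact le_rfl
      · positivity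
  have hcard : (Finset.univ.filter fun i : Fin N => (i : ℕ) < B).card ≤ B := by
    simpa using Finset.card_le_card_of_injOn (t := Finset.range B) (fun i : Fin N => (i : ℕ))
      (fun i hi => by simpa using hi) (fun _ _ _ _ h => Fin.ext h)
  calc tailSum N c j
      = ∑ i : Fin N, if (j : ℕ) ≤ (i : ℕ) then c i ^ 2 else 0 := by
        rw [tailSum, Finset.sum_filter]
    _ ≤ ∑ i : Fin N, ((if (i : ℕ) < B then c j ^ 2 else 0)
          + if B ≤ (i : ℕ) then c i ^ 2 else 0) := Finset.sum_le_sum fun i _ => hterm i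
    _ = (Finset.univ.filter fun i : Fin N => (i : ℕ) < B).card * c j ^ 2 + tailSum N c B := by
        rw [Finset.sum_add_distrib, ← Finset.sum_filter, Finset.sum_const, nsmul_eq_mul,
          tailSum, Finset.sum_filter (fun i : Fin N => B ≤ (i : ℕ))]
    _ ≤ B * c j ^ 2 + tailSum N c B := by gcongr

/-- The tail sum beyond the qualified length is within a factor `1 + ε` of the tail sum
from `B`. -/
theorem tailSum_qualLen_le {N B : ℕ} (hB : 0 < B) (c : Fin N → ℝ)
    (hsorted : ∀ i j : Fin N, i ≤ j → |c j| ≤ |c i|) {ε : ℝ} (hε : 0 < ε) :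
    tailSum N c (qualLen N c B (ε / (B * (1 + ε)))) ≤ (1 + ε) * tailSum N c B := by
  have hmem : qualLen N c B (ε / (B * (1 + ε))) ∈
      {j : ℕ | ∃ hj : j < N, j < B ∧ c ⟨j, hj⟩ ^ 2 < ε / (B * (1 + ε)) * tailSum N c j} ∪ {B} :=
    Nat.sInf_mem ⟨B, Or.inr rfl⟩
  generalize qualLen N c B (ε / (B * (1 + ε))) = m at hmem ⊢
  rcases hmem with ⟨hm, -, hlt⟩ | hm
  · have hle : tailSum N c m ≤ B * c ⟨m, hm⟩ ^ 2 + tailSum N c B :=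
      tailSum_le_mul_sq_add_tailSum c hsorted B ⟨m, hm⟩
    have hB' : (0 : ℝ) < B := Nat.cast_pos.mpr hB
    rw [div_mul_eq_mul_div, lt_div_iff₀ (by positivity)] at hlt
    nlinarith
  · rw [Set.mem_singleton_iff.mp hm]
    nlinarith [tailSum_nonneg N c B]

/-- Restricting `c` to any index set `S` containing the qualified index set
`Q_{c,B,ε/(B(1+ε))}` gives (unsquared) Euclidean error at most `(1+ε)` times that
of the best `B`-term approximation. -/
theorem superset_of_qualified_is_good_unsquared (N B : ℕ) (hN : 0 < N) (hB : 0 < B)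
    (hBN : B ≤ N)
    (c : Fin N → ℝ)
    (hsorted : ∀ i j : Fin N, i ≤ j → |c j| ≤ |c i|)
    (ε : ℝ) (hε : 0 < ε)
    (S : Finset (Fin N))
    (hS : ∀ i : Fin N, (i : ℕ) < qualLen N c B (ε / (B * (1 + ε))) → i ∈ S) :
    Real.sqrt (∑ i : Fin N, ((if i ∈ S then c i else 0) - c i) ^ 2)
      ≤ (1 + ε) *
        Real.sqrt (∑ i : Fin N, ((if (i : ℕ) < B then c i else 0) - c i) ^ 2) := by
  rw [sum_sq_prefix_sub_eq_tailSum]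
  refine Real.sqrt_le_iff.mpr ⟨by positivity, ?_⟩
  rw [mul_pow, Real.sq_sqrt (tailSum_nonneg N c B)]
  calc ∑ i : Fin N, ((if i ∈ S then c i else 0) - c i) ^ 2
      ≤ tailSum N c (qualLen N c B (ε / (B * (1 + ε)))) :=
        sum_sq_restrict_sub_le_tailSum c _ S hS
    _ ≤ (1 + ε) * tailSum N c B := tailSum_qualLen_le hB c hsorted hε
    _ ≤ (1 + ε) ^ 2 * tailSum N c B := by
        have := tailSum_nonneg N c B
        gcongr
        nlinarith
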